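/- arXiv:2308.09143 — 2 statements merged into one kernel-verified Lean document; each statement's English description precedes it below -/
import Mathlib

section
/- Let Ω ⊂ ℂ^N be a bounded strongly pseudoconvex domain with C^{2,α}-smooth boundary, α ∈ (0,1]. Then there exist constants 0 < c < C depending only on Ω such that for all z, w ∈ Ω sufficiently close to ∂Ω (so that the closest boundary points π_Ω(z), π_Ω(w) are unique): c ≤ [(A_Ω(z,w) + 1)·δ_Ω(z)^{1/2}·δ_Ω(w)^{1/2}] / [‖(π_Ω(z)−π_Ω(w))_{π_Ω(z)}‖ + ‖π_Ω(z)−π_Ω(w)‖² + max{δ_Ω(z), δ_Ω(w)}] ≤ C, where (π_Ω(z)−π_Ω(w))_{π_Ω(z)} := ⟨π_Ω(z)−π_Ω(w), η_{π(z)}⟩. -/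
open Metric Set Filter Topology MeasureTheory

noncomputable section

namespace InvDist

/-- Complex Euclidean `N`-space. -/
abbrev E (N : ℕ) := EuclideanSpace ℂ (Fin N)

variable {N : ℕ}

/-- The paper's Hermitian product `⟨a,b⟩ = ∑ a_j * conj (b_j)`. -/
def herm (a b : E N) : ℂ := ∑ j, a j * (starRingEnd ℂ) (b j)

/-- Euclidean distance to the boundary of `Ω`. -/
def bdist (Ω : Set (E N)) (x : E N) : ℝ := Metric.infDist x (frontier Ω)

/-- `π` selects, for each point of `Ω`, a closest point on the boundary. -/
def IsClosestPointSelection (Ω : Set (E N)) (π : E N → E N) : Prop :=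
  ∀ z ∈ Ω, π z ∈ frontier Ω ∧ dist z (π z) = bdist Ω z

/-- `‖v_z‖`: modulus of the complex normal component of `v` with respect to the
closest boundary point `π z`; the outer unit normal at `π z` is `(π z - z)/‖π z - z‖`. -/
def ncomp (Ω : Set (E N)) (π : E N → E N) (z v : E N) : ℝ :=
  ‖herm v (π z - z)‖ / bdist Ω z

/-- `‖v_z^ℝ‖`: modulus of the real normal component of `v` at `π z`. -/
def ncompR (Ω : Set (E N)) (π : E N → E N) (z v : E N) : ℝ :=
  |(herm v (π z - z)).re| / bdist Ω z

/-- The quantity `A_Ω(z,w)`. -/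
def Afun (Ω : Set (E N)) (π : E N → E N) (z w : E N) : ℝ :=
  (ncomp Ω π z (z - w) + ‖z - w‖ ^ 2 + ‖z - w‖ * Real.sqrt (bdist Ω z)) /
    (Real.sqrt (bdist Ω z) * Real.sqrt (bdist Ω w))

/-- `h_Ω(z,w) = ‖(z-w)_z‖ + ‖z-w‖ δ_Ω(z)^{1/2}`. -/
def hfun (Ω : Set (E N)) (π : E N → E N) (z w : E N) : ℝ :=
  ncomp Ω π z (z - w) + ‖z - w‖ * Real.sqrt (bdist Ω z)

/-- real analogue of `h_Ω`. -/
def hfunR (Ω : Set (E N)) (π : E N → E N) (z w : E N) : ℝ :=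
  ncompR Ω π z (z - w) + ‖z - w‖ * Real.sqrt (bdist Ω z)

/-- inverse hyperbolic tangent -/
def artanh (x : ℝ) : ℝ := Real.log ((1 + x) / (1 - x)) / 2

/-- The Lempert function of `Ω`. -/
def lempert (Ω : Set (E N)) (z w : E N) : ℝ :=
  artanh (sInf { r : ℝ | ∃ φ : ℂ → E N, DifferentiableOn ℂ φ (ball 0 1) ∧
    MapsTo φ (ball (0:ℂ) 1) Ω ∧ φ 0 = z ∧ ∃ a ∈ ball (0:ℂ) 1, φ a = w ∧ r = ‖a‖ })

/-- The Carathéodory distance of `Ω`. -/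
def caratheodory (Ω : Set (E N)) (z w : E N) : ℝ :=
  artanh (sSup { r : ℝ | ∃ f : E N → ℂ, DifferentiableOn ℂ f Ω ∧
    MapsTo f Ω (ball (0:ℂ) 1) ∧ f z = 0 ∧ r = ‖f w‖ })

/-- The Kobayashi distance: the largest pseudodistance not exceeding the Lempert
function, given as an infimum over chains. -/
def kobayashi (Ω : Set (E N)) (z w : E N) : ℝ :=
  sInf { r : ℝ | ∃ (n : ℕ) (p : Fin (n + 1) → E N), p 0 = z ∧ p (Fin.last n) = w ∧
    (∀ i, p i ∈ Ω) ∧ r = ∑ i : Fin n, lempert Ω (p i.castSucc) (p i.succ) }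

/-- The Poincaré distance on the unit disc. -/
def poincare (ζ ξ : ℂ) : ℝ := artanh ‖(ζ - ξ) / (1 - (starRingEnd ℂ) ζ * ξ)‖

/-- A complex geodesic of `Ω`. -/
def IsComplexGeodesic (Ω : Set (E N)) (φ : ℂ → E N) : Prop :=
  DifferentiableOn ℂ φ (ball 0 1) ∧ MapsTo φ (ball (0:ℂ) 1) Ω ∧
    ∀ ζ ∈ ball (0:ℂ) 1, ∀ ξ ∈ ball (0:ℂ) 1, kobayashi Ω (φ ζ) (φ ξ) = poincare ζ ξ

/-- `ρ` is `C^k` on `U` with `α`-Hölder `k`-th derivative. -/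
def IsCkHolderOn (k : ℕ) (α : ℝ) (ρ : E N → ℝ) (U : Set (E N)) : Prop :=
  ContDiffOn ℝ k ρ U ∧ ∃ M : ℝ, ∀ x ∈ U, ∀ y ∈ U,
    ‖iteratedFDeriv ℝ k ρ x - iteratedFDeriv ℝ k ρ y‖ ≤ M * ‖x - y‖ ^ α

/-- The Levi form of `ρ` at `p` evaluated at `v`. -/
def levi (ρ : E N → ℝ) (p v : E N) : ℝ :=
  (iteratedFDeriv ℝ 2 ρ p ![v, v] +
    iteratedFDeriv ℝ 2 ρ p ![(Complex.I : ℂ) • v, (Complex.I : ℂ) • v]) / 4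

/-- Bounded strongly pseudoconvex domain with `C^{k,α}`-smooth boundary. -/
def IsStronglyPseudoconvexDomain (k : ℕ) (α : ℝ) (Ω : Set (E N)) : Prop :=
  IsOpen Ω ∧ IsConnected Ω ∧ Bornology.IsBounded Ω ∧
  ∃ (U : Set (E N)) (ρ : E N → ℝ), IsOpen U ∧ closure Ω ⊆ U ∧
    IsCkHolderOn k α ρ U ∧ Ω = {x ∈ U | ρ x < 0} ∧
    (∀ p ∈ frontier Ω, fderiv ℝ ρ p ≠ 0) ∧
    ∀ p ∈ frontier Ω, ∀ v : E N, v ≠ 0 → fderiv ℝ ρ p v = 0 →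
      fderiv ℝ ρ p ((Complex.I : ℂ) • v) = 0 → 0 < levi ρ p v

/-- `η` is the outer unit normal of `Ω` at the boundary point `p`. -/
def IsOuterUnitNormalAt (Ω : Set (E N)) (p η : E N) : Prop :=
  ‖η‖ = 1 ∧ p ∈ frontier Ω ∧ ∃ ε > 0, ∀ t : ℝ, 0 < t → t < ε →
    p - t • η ∈ Ω ∧ bdist Ω (p - t • η) = t

open Classical in
/-- signed boundary distance -/
def signedDist (Ω : Set (E N)) (x : E N) : ℝ :=
  if x ∈ closure Ω then -(bdist Ω x) else bdist Ω x

/-- Hessian quadratic form of the signed boundary distance. -/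
def hessSD (Ω : Set (E N)) (p v : E N) : ℝ :=
  iteratedFDeriv ℝ 2 (signedDist Ω) p ![v, v]

/-- strict linear convexity at `p` (with outer unit normal `η`). -/
def StrictlyLinearlyConvexAt (Ω : Set (E N)) (p η : E N) : Prop :=
  ∀ v : E N, v ≠ 0 → herm v η = 0 → 0 < hessSD Ω p v

/-- strong convexity at `p` (with outer unit normal `η`). -/
def StronglyConvexAt (Ω : Set (E N)) (p η : E N) : Prop :=
  ∀ v : E N, v ≠ 0 → (herm v η).re = 0 → 0 < hessSD Ω p v

/-- `p` is a `C^k`-smooth boundary point of `Ω`. -/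
def IsCkBoundaryPoint (k : ℕ) (Ω : Set (E N)) (p : E N) : Prop :=
  p ∈ frontier Ω ∧ ∃ (U : Set (E N)) (ρ : E N → ℝ), IsOpen U ∧ p ∈ U ∧
    ContDiffOn ℝ k ρ U ∧ (∀ x ∈ U, (x ∈ Ω ↔ ρ x < 0)) ∧
    ∀ x ∈ U ∩ frontier Ω, fderiv ℝ ρ x ≠ 0

/-- bounded domain with `C^k`-smooth boundary. -/
def IsCkDomain (k : ℕ) (Ω : Set (E N)) : Prop :=
  IsOpen Ω ∧ IsConnected Ω ∧ Bornology.IsBounded Ω ∧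
    ∀ p ∈ frontier Ω, IsCkBoundaryPoint k Ω p

/-- bounded domain with `C^{1,1}`-smooth boundary. -/
def IsC11Domain (Ω : Set (E N)) : Prop :=
  IsOpen Ω ∧ IsConnected Ω ∧ Bornology.IsBounded Ω ∧
  ∀ p ∈ frontier Ω, ∃ (U : Set (E N)) (ρ : E N → ℝ), IsOpen U ∧ p ∈ U ∧
    IsCkHolderOn 1 1 ρ U ∧ (∀ x ∈ U, (x ∈ Ω ↔ ρ x < 0)) ∧
    ∀ x ∈ U ∩ frontier Ω, fderiv ℝ ρ x ≠ 0

/-- `p` is a `C^{2,α}`-smooth strongly pseudoconvex boundary point of `Ω`. -/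
def IsSPSCBoundaryPoint (α : ℝ) (Ω : Set (E N)) (p : E N) : Prop :=
  p ∈ frontier Ω ∧ ∃ (U : Set (E N)) (ρ : E N → ℝ), IsOpen U ∧ p ∈ U ∧
    IsCkHolderOn 2 α ρ U ∧ (∀ x ∈ U, (x ∈ Ω ↔ ρ x < 0)) ∧
    (∀ x ∈ U ∩ frontier Ω, fderiv ℝ ρ x ≠ 0) ∧
    ∀ x ∈ U ∩ frontier Ω, ∀ v : E N, v ≠ 0 → fderiv ℝ ρ x v = 0 →
      fderiv ℝ ρ x ((Complex.I : ℂ) • v) = 0 → 0 < levi ρ x v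

instance (N : ℕ) : MeasurableSpace (E N) := borel _

instance (N : ℕ) : BorelSpace (E N) := ⟨rfl⟩

/-- Lebesgue measure on `E N`. -/
def vol (N : ℕ) : Measure (E N) :=
  letI : InnerProductSpace ℝ (E N) := InnerProductSpace.rclikeToReal ℂ (E N)
  letI : MeasureSpace (E N) := measureSpaceOfInnerProductSpace
  volume

/-- Bergman kernel on the diagonal. -/
def bergmanKernelDiag (Ω : Set (E N)) (z : E N) : ℝ :=
  sSup { r : ℝ | ∃ f : E N → ℂ, DifferentiableOn ℂ f Ω ∧
    (∫ x in Ω, ‖f x‖ ^ 2 ∂(vol N)) ≤ 1 ∧ r = ‖f z‖ ^ 2 }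

/-- `M_Ω(z;v)`. -/
def bergmanM (Ω : Set (E N)) (z v : E N) : ℝ :=
  sSup { r : ℝ | ∃ f : E N → ℂ, DifferentiableOn ℂ f Ω ∧
    (∫ x in Ω, ‖f x‖ ^ 2 ∂(vol N)) ≤ 1 ∧ f z = 0 ∧ r = ‖fderiv ℂ f z v‖ }

/-- The Bergman metric. -/
def bergmanMetric (Ω : Set (E N)) (z v : E N) : ℝ :=
  bergmanM Ω z v / Real.sqrt (bergmanKernelDiag Ω z)

/-- The Bergman distance: inner distance of the Bergman metric. -/
def bergmanDist (Ω : Set (E N)) (z w : E N) : ℝ :=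
  sInf { r : ℝ | ∃ γ : ℝ → E N, ContDiffOn ℝ 1 γ (Icc 0 1) ∧ γ 0 = z ∧ γ 1 = w ∧
    (∀ t ∈ Icc (0:ℝ) 1, γ t ∈ Ω) ∧
    r = ∫ t in (0:ℝ)..(1:ℝ), bergmanMetric Ω (γ t) (derivWithin γ (Icc 0 1) t) }


section RealGeometry

variable {V : Type*} [NormedAddCommGroup V]

/-- A `C^1` map is Lipschitz, uniformly from the points of a compact set to nearby points. -/
theorem exists_lipschitz_near_compact [NormedSpace ℝ V] [ProperSpace V]
    {G : Type*} [NormedAddCommGroup G] [NormedSpace ℝ G] {S U : Set V} {f : V → G}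
    (hS : IsCompact S) (hU : IsOpen U) (hSU : S ⊆ U) (hf : ContDiffOn ℝ 1 f U) :
    ∃ r > 0, ∃ K > 0, ∀ p ∈ S, closedBall p r ⊆ U ∧
      ∀ x ∈ closedBall p r, ‖f x - f p‖ ≤ K * ‖x - p‖ := by
  obtain ⟨r, hr, hrU⟩ := hS.exists_cthickening_subset_open hU hSU
  have hc : IsCompact (cthickening r S) := hS.cthickening
  have hcont : ContinuousOn (fderiv ℝ f) (cthickening r S) :=
    (hf.continuousOn_fderiv_of_isOpen hU le_rfl).mono hrU
  obtain ⟨K, hK⟩ := hc.exists_bound_of_continuousOn hcont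
  refine ⟨r, hr, max K 1, by positivity, fun p hp => ?_⟩
  have hb : closedBall p r ⊆ cthickening r S := closedBall_subset_cthickening hp r
  refine ⟨hb.trans hrU, fun x hx => ?_⟩
  exact (convex_closedBall p r).norm_image_sub_le_of_norm_fderiv_le
    (fun y hy => (hf.differentiableOn one_ne_zero).differentiableAt (hU.mem_nhds (hrU (hb hy))))
    (fun y hy => (hK y (hb hy)).trans (le_max_left _ _))
    (mem_closedBall_self hr.le) hx

/-- The closed ball about a point of an open set whose radius is the distance to the frontier is
contained in the closure of the set. -/
theorem closedBall_infDist_frontier_subset_closure [NormedSpace ℝ V] {Ω : Set V} {z : V}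
    (hΩ : IsOpen Ω) (hz : z ∈ Ω) (hpos : 0 < infDist z (frontier Ω)) :
    closedBall z (infDist z (frontier Ω)) ⊆ closure Ω := by
  rw [← closure_ball z hpos.ne']
  refine closure_mono ?_
  refine (convex_ball _ _).isPreconnected.subset_of_closure_inter_subset hΩ
    ⟨z, mem_ball_self hpos, hz⟩ fun y hy => ?_
  by_contra hyΩ
  have hle := infDist_le_dist_of_mem (x := z) (hΩ.frontier_eq ▸ ⟨hy.1, hyΩ⟩ : y ∈ frontier Ω)
  rw [dist_comm] at hle
  exact (mem_ball.1 hy.2).not_ge hle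

variable [InnerProductSpace ℝ V]

/-- If a function on a closed ball is maximal at a point of the boundary sphere, its derivative
there is a nonnegative multiple of the inner product with the outer unit normal. -/
theorem fderiv_eq_norm_mul_inner_of_isMaxOn_closedBall [CompleteSpace V] {ρ : V → ℝ} {z p : V}
    {δ : ℝ} (hδ : 0 < δ) (hp : ‖p - z‖ = δ) (hρ : DifferentiableAt ℝ ρ p)
    (hmax : IsMaxOn ρ (closedBall z δ) p) (v : V) :
    fderiv ℝ ρ p v = ‖fderiv ℝ ρ p‖ * inner ℝ (δ⁻¹ • (p - z)) v := by
  set φ := fderiv ℝ ρ p with hφ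
  set g := (InnerProductSpace.toDual ℝ V).symm φ with hg
  have hgv : ∀ u, φ u = inner ℝ g u := fun u => by simp [hg]
  have hgn : ‖φ‖ = ‖g‖ := by simp [hg]
  have hpb : p ∈ closedBall z δ := by rw [mem_closedBall, dist_eq_norm, hp]
  have hle : ∀ y ∈ closedBall z δ, φ (y - p) ≤ 0 := fun y hy =>
    (hmax.localize).hasFDerivWithinAt_nonpos hρ.hasFDerivAt.hasFDerivWithinAt
      (sub_mem_posTangentConeAt_of_segment_subset
        ((convex_closedBall z δ).segment_subset hpb hy))
  set n := δ⁻¹ • (p - z) with hn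
  have hn1 : ‖n‖ = 1 := by
    rw [hn, norm_smul, hp, norm_inv, Real.norm_of_nonneg hδ.le, inv_mul_cancel₀ hδ.ne']
  have hpz : p - z = δ • n := by rw [hn, smul_inv_smul₀ hδ.ne']
  rw [hgn, hgv]
  rcases eq_or_ne g 0 with h0 | h0
  · simp [h0]
  have hgpos : 0 < ‖g‖ := norm_pos_iff.2 h0
  have h1 : ‖g‖ ≤ inner ℝ g n := by
    have h := hle (z + (δ * ‖g‖⁻¹) • g) (by
      rw [mem_closedBall, dist_eq_norm, add_sub_cancel_left, norm_smul, norm_mul, norm_inv,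
        norm_norm, Real.norm_of_nonneg hδ.le, mul_assoc, inv_mul_cancel₀ hgpos.ne', mul_one])
    have he : z + (δ * ‖g‖⁻¹) • g - p = (δ * ‖g‖⁻¹) • g - δ • n := by rw [← hpz]; abel
    rw [he, hgv, inner_sub_right, real_inner_smul_right, real_inner_smul_right,
      real_inner_self_eq_norm_sq] at h
    have : δ * ‖g‖⁻¹ * ‖g‖ ^ 2 = δ * ‖g‖ := by field_simp
    rw [this] at h
    exact le_of_mul_le_mul_left (by linarith) hδ
  have h2 : ‖g - ‖g‖ • n‖ ^ 2 ≤ 0 := by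
    rw [norm_sub_sq_real, real_inner_smul_right, norm_smul, norm_norm, hn1]
    nlinarith
  have h3 : g = ‖g‖ • n := by
    rw [← sub_eq_zero, ← norm_eq_zero]
    exact pow_eq_zero_iff (two_ne_zero) |>.1 (le_antisymm h2 (by positivity))
  conv_lhs => rw [h3]
  rw [real_inner_smul_left]

/-- For a bounded domain with a `C^2` defining function, the unit normals at closest boundary
points are Lipschitz, and chords of the boundary are tangential to second order. -/
theorem exists_normal_bounds [ProperSpace V] {Ω U : Set V} {ρ : V → ℝ} (hΩ : IsOpen Ω)
    (hb : Bornology.IsBounded Ω) (hU : IsOpen U) (hΩU : closure Ω ⊆ U)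
    (hρ : ContDiffOn ℝ 2 ρ U) (hΩρ : Ω = {x ∈ U | ρ x < 0})
    (hd : ∀ p ∈ frontier Ω, fderiv ℝ ρ p ≠ 0) :
    ∃ K > 0, ∀ z ∈ Ω, ∀ w ∈ Ω, ∀ p ∈ frontier Ω, ∀ q ∈ frontier Ω,
      0 < infDist z (frontier Ω) → 0 < infDist w (frontier Ω) →
      ‖p - z‖ = infDist z (frontier Ω) → ‖q - w‖ = infDist w (frontier Ω) →
      |inner ℝ ((infDist z (frontier Ω))⁻¹ • (p - z)) (p - q)| ≤ K * ‖p - q‖ ^ 2 ∧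
      ‖(infDist z (frontier Ω))⁻¹ • (p - z) - (infDist w (frontier Ω))⁻¹ • (q - w)‖
        ≤ K * ‖p - q‖ := by
  have hfc : IsCompact (frontier Ω) :=
    isCompact_of_isClosed_isBounded isClosed_frontier (hb.closure.subset frontier_subset_closure)
  have hfU : frontier Ω ⊆ U := frontier_subset_closure.trans hΩU
  have hle : ∀ x ∈ closure Ω, ρ x ≤ 0 := by
    intro x hx
    have hcx : ContinuousWithinAt ρ Ω x :=
      (hρ.continuousOn.continuousAt (hU.mem_nhds (hΩU hx))).continuousWithinAt
    have := hcx.mem_closure (t := Iic 0) hx (fun y hy => by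
      rw [hΩρ] at hy
      exact hy.2.le)
    simpa using this
  have hzero : ∀ p ∈ frontier Ω, ρ p = 0 := by
    intro p hp
    refine le_antisymm (hle p (frontier_subset_closure hp)) (not_lt.1 fun hlt => ?_)
    have hpΩ : p ∈ Ω := by
      rw [hΩρ]
      exact ⟨hfU hp, hlt⟩
    exact (hΩ.frontier_eq ▸ hp).2 hpΩ
  have hdiff : ∀ x ∈ U, DifferentiableAt ℝ ρ x := fun x hx =>
    (hρ.differentiableOn two_ne_zero).differentiableAt (hU.mem_nhds hx)
  have hfd : ContDiffOn ℝ 1 (fderiv ℝ ρ) U := hρ.fderiv_of_isOpen hU (by norm_num)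
  obtain ⟨r, hr, K, hK, hKr⟩ := exists_lipschitz_near_compact hfc hU hfU hfd
  obtain ⟨m, hm, hmle⟩ : ∃ m > 0, ∀ p ∈ frontier Ω, m ≤ ‖fderiv ℝ ρ p‖ := by
    rcases (frontier Ω).eq_empty_or_nonempty with he | hne
    · exact ⟨1, one_pos, by simp [he]⟩
    · obtain ⟨p, hp, hpm⟩ := hfc.exists_isMinOn hne (hfd.continuousOn.mono hfU).norm
      exact ⟨_, norm_pos_iff.2 (hd p hp), fun q hq => hpm hq⟩
  refine ⟨2 * K / m + 2 / r, by positivity, ?_⟩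
  intro z hz w hw p hp q hq hδ hδ' hpz hqw
  have hnorm : ∀ {z p : V}, z ∈ Ω → p ∈ frontier Ω → 0 < infDist z (frontier Ω) →
      ‖p - z‖ = infDist z (frontier Ω) → ∀ v, fderiv ℝ ρ p v =
        ‖fderiv ℝ ρ p‖ * inner ℝ ((infDist z (frontier Ω))⁻¹ • (p - z)) v := by
    intro z p hz hp hδ hpz
    refine fderiv_eq_norm_mul_inner_of_isMaxOn_closedBall hδ hpz (hdiff p (hfU hp)) ?_
    intro y hy
    change ρ y ≤ ρ p
    rw [hzero p hp]
    exact hle y (closedBall_infDist_frontier_subset_closure hΩ hz hδ hy)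
  have hunit : ∀ {z p : V}, 0 < infDist z (frontier Ω) →
      ‖p - z‖ = infDist z (frontier Ω) → ‖(infDist z (frontier Ω))⁻¹ • (p - z)‖ = 1 := by
    intro z p hδ hpz
    rw [norm_smul, hpz, norm_inv, Real.norm_of_nonneg hδ.le, inv_mul_cancel₀ hδ.ne']
  have hp' := hnorm hz hp hδ hpz
  have hq' := hnorm hw hq hδ' hqw
  have hn := hunit hδ hpz
  have hn' := hunit hδ' hqw
  set n := (infDist z (frontier Ω))⁻¹ • (p - z)
  set n' := (infDist w (frontier Ω))⁻¹ • (q - w)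
  rw [add_mul, add_mul]
  rcases le_or_gt ‖p - q‖ r with hnear | hfar
  · have hqb : q ∈ closedBall p r := by rwa [mem_closedBall, dist_comm, dist_eq_norm]
    have hmp := hmle p hp
    have hKq := (hKr p hp).2 q hqb
    have hseg : ‖ρ q - ρ p - fderiv ℝ ρ p (q - p)‖ ≤ K * ‖q - p‖ * ‖q - p‖ := by
      refine (convex_segment p q).norm_image_sub_le_of_norm_fderiv_le' (𝕜 := ℝ)
        (fun x hx => hdiff x ?_) (fun x hx => ?_) (left_mem_segment ℝ p q)
        (right_mem_segment ℝ p q)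
      · exact (hKr p hp).1 ((convex_closedBall p r).segment_subset
          (mem_closedBall_self hr.le) hqb hx)
      · refine ((hKr p hp).2 x ((convex_closedBall p r).segment_subset
          (mem_closedBall_self hr.le) hqb hx)).trans ?_
        have : ‖x - p‖ ≤ ‖q - p‖ := by
          have h := segment_subset_closedBall_left p q hx
          rwa [mem_closedBall, dist_eq_norm, dist_comm, dist_eq_norm] at h
        gcongr
    rw [norm_sub_rev q p] at hKq hseg
    rw [hzero p hp, hzero q hq, hp', ← neg_sub p q, inner_neg_right, Real.norm_eq_abs] at hseg
    have hseg' : ‖fderiv ℝ ρ p‖ * |inner ℝ n (p - q)| ≤ K * ‖p - q‖ * ‖p - q‖ := by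
      rwa [sub_self, zero_sub, mul_neg, neg_neg, abs_mul, abs_norm] at hseg
    have hfg : ‖‖fderiv ℝ ρ q‖ • n' - ‖fderiv ℝ ρ p‖ • n‖ ≤ K * ‖p - q‖ := by
      refine le_trans ?_ hKq
      have hv := (fderiv ℝ ρ q - fderiv ℝ ρ p).le_opNorm
        (‖fderiv ℝ ρ q‖ • n' - ‖fderiv ℝ ρ p‖ • n)
      rw [sub_apply, hp', hq', ← real_inner_smul_left,
        ← real_inner_smul_left, ← inner_sub_left, real_inner_self_eq_norm_sq,
        Real.norm_of_nonneg (by positivity), sq] at hv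
      rcases (norm_nonneg (‖fderiv ℝ ρ q‖ • n' - ‖fderiv ℝ ρ p‖ • n)).eq_or_lt with h0 | h0
      · rw [← h0]
        positivity
      · exact le_of_mul_le_mul_right hv h0
    have hnn : ‖fderiv ℝ ρ p‖ * ‖n - n'‖ ≤ 2 * K * ‖p - q‖ := by
      have he : ‖fderiv ℝ ρ p‖ • (n - n') = (‖fderiv ℝ ρ q‖ - ‖fderiv ℝ ρ p‖) • n' -
          (‖fderiv ℝ ρ q‖ • n' - ‖fderiv ℝ ρ p‖ • n) := by module
      have h1 : ‖‖fderiv ℝ ρ p‖ • (n - n')‖ ≤ |‖fderiv ℝ ρ q‖ - ‖fderiv ℝ ρ p‖| * ‖n'‖ +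
          K * ‖p - q‖ := by
        rw [he]
        refine (norm_sub_le _ _).trans (add_le_add ?_ hfg)
        rw [norm_smul, Real.norm_eq_abs]
      rw [norm_smul, norm_norm, hn', mul_one] at h1
      linarith [abs_norm_sub_norm_le (fderiv ℝ ρ q) (fderiv ℝ ρ p)]
    constructor
    · have h1 : m * |inner ℝ n (p - q)| ≤ 2 * K * ‖p - q‖ ^ 2 := by
        nlinarith [mul_le_mul_of_nonneg_right hmp (abs_nonneg (inner ℝ n (p - q))),
          mul_nonneg hK.le (sq_nonneg ‖p - q‖)]
      have h2 : |inner ℝ n (p - q)| ≤ 2 * K / m * ‖p - q‖ ^ 2 := by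
        rw [div_mul_eq_mul_div, le_div_iff₀ hm, mul_comm]
        exact h1
      have : 0 ≤ 2 / r * ‖p - q‖ ^ 2 := by positivity
      linarith
    · have h2 : ‖n - n'‖ ≤ 2 * K / m * ‖p - q‖ := by
        rw [div_mul_eq_mul_div, le_div_iff₀ hm, mul_comm]
        exact (mul_le_mul_of_nonneg_right hmp (norm_nonneg _)).trans hnn
      have : 0 ≤ 2 / r * ‖p - q‖ := by positivity
      linarith
  · have h2 : 2 ≤ 2 / r * ‖p - q‖ := by
      rw [div_mul_eq_mul_div, le_div_iff₀ hr]
      linarith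
    constructor
    · have h1 := abs_real_inner_le_norm n (p - q)
      rw [hn, one_mul] at h1
      have h3 : 0 ≤ 2 * K / m * ‖p - q‖ ^ 2 := by positivity
      nlinarith [norm_nonneg (p - q)]
    · have h1 := norm_sub_le n n'
      rw [hn, hn'] at h1
      have h3 : 0 ≤ 2 * K / m * ‖p - q‖ := by positivity
      linarith

/-- Close to the boundary, closest point maps are `2`-Lipschitz and the difference of the boundary
distances is controlled by the real normal component up to a quadratic error. -/
theorem exists_closest_point_bounds [ProperSpace V] {Ω U : Set V} {ρ : V → ℝ} (hΩ : IsOpen Ω)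
    (hb : Bornology.IsBounded Ω) (hU : IsOpen U) (hΩU : closure Ω ⊆ U)
    (hρ : ContDiffOn ℝ 2 ρ U) (hΩρ : Ω = {x ∈ U | ρ x < 0})
    (hd : ∀ p ∈ frontier Ω, fderiv ℝ ρ p ≠ 0) :
    ∃ ε > 0, ε ≤ 1 ∧ ∃ K > 0, ∀ z ∈ Ω, ∀ w ∈ Ω, ∀ p ∈ frontier Ω, ∀ q ∈ frontier Ω,
      0 < infDist z (frontier Ω) → 0 < infDist w (frontier Ω) →
      infDist z (frontier Ω) < ε → infDist w (frontier Ω) < ε →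
      ‖p - z‖ = infDist z (frontier Ω) → ‖q - w‖ = infDist w (frontier Ω) →
      ‖p - q‖ ≤ 2 * ‖z - w‖ ∧
      |infDist z (frontier Ω) - infDist w (frontier Ω)| ≤
        |inner ℝ ((infDist z (frontier Ω))⁻¹ • (p - z)) (z - w)| + K * ‖z - w‖ ^ 2 := by
  obtain ⟨K, hK, hKn⟩ := exists_normal_bounds hΩ hb hU hΩU hρ hΩρ hd
  refine ⟨min 1 (1 / (4 * K)), by positivity, min_le_left _ _, 4 * (K + K ^ 2),
    by positivity, ?_⟩
  intro z hz w hw p hp q hq hδ hδ' hε hε' hpz hqw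
  obtain ⟨h1, h2⟩ := hKn z hz w hw p hp q hq hδ hδ' hpz hqw
  obtain ⟨h3, -⟩ := hKn w hw z hz q hq p hp hδ' hδ hqw hpz
  rw [lt_min_iff, lt_div_iff₀ (by positivity)] at hε hε'
  set δ := infDist z (frontier Ω)
  set δ' := infDist w (frontier Ω)
  have hn : ‖δ⁻¹ • (p - z)‖ = 1 := by
    rw [norm_smul, hpz, norm_inv, Real.norm_of_nonneg hδ.le, inv_mul_cancel₀ hδ.ne']
  have hn' : ‖δ'⁻¹ • (q - w)‖ = 1 := by
    rw [norm_smul, hqw, norm_inv, Real.norm_of_nonneg hδ'.le, inv_mul_cancel₀ hδ'.ne']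
  have hz' : p - z = δ • (δ⁻¹ • (p - z)) := by rw [smul_inv_smul₀ hδ.ne']
  have hw' : q - w = δ' • (δ'⁻¹ • (q - w)) := by rw [smul_inv_smul₀ hδ'.ne']
  generalize δ⁻¹ • (p - z) = n at *
  generalize δ'⁻¹ • (q - w) = n' at *
  have hzw : z - w = (p - q) - δ • n + δ' • n' := by
    rw [← hz', ← hw']
    abel
  have h3' : |inner ℝ n' (p - q)| ≤ K * ‖p - q‖ ^ 2 := by
    rw [← abs_neg, ← inner_neg_right, neg_sub, norm_sub_rev p q]
    exact h3
  have hlip : ‖p - q‖ ≤ 2 * ‖z - w‖ := by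
    have hi : inner ℝ (z - w) (p - q) =
        ‖p - q‖ ^ 2 - δ * inner ℝ n (p - q) + δ' * inner ℝ n' (p - q) := by
      rw [hzw, inner_add_left, inner_sub_left, real_inner_smul_left, real_inner_smul_left,
        real_inner_self_eq_norm_sq]
    have hcs := real_inner_le_norm (z - w) (p - q)
    have ha : δ * inner ℝ n (p - q) ≤ 1 / 4 * ‖p - q‖ ^ 2 := by
      nlinarith [mul_le_mul_of_nonneg_left ((le_abs_self _).trans h1) hδ.le,
        sq_nonneg ‖p - q‖]
    have hb : -(1 / 4 * ‖p - q‖ ^ 2) ≤ δ' * inner ℝ n' (p - q) := by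
      nlinarith [mul_le_mul_of_nonneg_left ((neg_abs_le _).trans' (neg_le_neg h3')) hδ'.le,
        sq_nonneg ‖p - q‖]
    rcases (norm_nonneg (p - q)).eq_or_lt with h0 | h0
    · rw [← h0]
      positivity
    · refine le_of_mul_le_mul_right ?_ h0
      nlinarith
  refine ⟨hlip, ?_⟩
  have hnn : inner ℝ n n' = 1 - ‖n - n'‖ ^ 2 / 2 := by
    rw [norm_sub_sq_real, hn, hn']
    ring
  have hi : inner ℝ n (z - w) = inner ℝ n (p - q) - (δ - δ') - δ' * (‖n - n'‖ ^ 2 / 2) := by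
    rw [hzw, inner_add_right, inner_sub_right, real_inner_smul_right, real_inner_smul_right,
      real_inner_self_eq_norm_sq, hn, hnn]
    ring
  have hsq : δ' * (‖n - n'‖ ^ 2 / 2) ≤ K ^ 2 * ‖p - q‖ ^ 2 := by
    have : ‖n - n'‖ ^ 2 ≤ (K * ‖p - q‖) ^ 2 := by gcongr
    nlinarith [sq_nonneg ‖n - n'‖, hε'.1]
  have hsq0 : 0 ≤ δ' * (‖n - n'‖ ^ 2 / 2) := by positivity
  have hd2 : (K + K ^ 2) * ‖p - q‖ ^ 2 ≤ 4 * (K + K ^ 2) * ‖z - w‖ ^ 2 := by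
    have : ‖p - q‖ ^ 2 ≤ (2 * ‖z - w‖) ^ 2 := by gcongr
    nlinarith [mul_le_mul_of_nonneg_left this (by positivity : 0 ≤ K + K ^ 2)]
  have hb1 := abs_le.1 h1
  rw [abs_le]
  constructor
  · linarith [le_abs_self (inner ℝ n (z - w))]
  · linarith [neg_abs_le (inner ℝ n (z - w))]

end RealGeometry

theorem herm_eq_inner (a b : E N) : herm a b = inner ℂ b a := by
  simp [herm, PiLp.inner_apply]

theorem ncomp_eq_norm_inner (Ω : Set (E N)) (π : E N → E N) (z v : E N) :
    ncomp Ω π z v = ‖inner ℂ ((bdist Ω z)⁻¹ • (π z - z)) v‖ := by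
  have h : 0 ≤ bdist Ω z := infDist_nonneg
  rw [ncomp, herm_eq_inner, ← Complex.coe_smul, inner_smul_left, norm_mul, RCLike.norm_conj,
    Complex.norm_real, norm_inv, Real.norm_of_nonneg h, div_eq_inv_mul]

/-- Comparison of `(A_Ω + 1)·δ^{1/2}δ^{1/2}` with the boundary
quantity built from the projections `π_Ω(z), π_Ω(w)`. -/
theorem stmt9 {N : ℕ} {α : ℝ} (hα : α ∈ Set.Ioc (0:ℝ) 1)
    (Ω : Set (E N)) (hΩ : IsStronglyPseudoconvexDomain 2 α Ω)
    (π : E N → E N) (hπ : IsClosestPointSelection Ω π) :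
    ∃ ε : ℝ, 0 < ε ∧ ∃ c C : ℝ, 0 < c ∧ c < C ∧
      ∀ z ∈ Ω, ∀ w ∈ Ω, bdist Ω z < ε → bdist Ω w < ε →
        c * (ncomp Ω π z (π z - π w) + ‖π z - π w‖ ^ 2 + max (bdist Ω z) (bdist Ω w)) ≤
          (Afun Ω π z w + 1) * (Real.sqrt (bdist Ω z) * Real.sqrt (bdist Ω w)) ∧
        (Afun Ω π z w + 1) * (Real.sqrt (bdist Ω z) * Real.sqrt (bdist Ω w)) ≤
          C * (ncomp Ω π z (π z - π w) + ‖π z - π w‖ ^ 2 + max (bdist Ω z) (bdist Ω w)) := by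
  obtain ⟨ho, -, hb, U, ρ, hU, hΩU, ⟨hρ, -⟩, hΩρ, hd, -⟩ := hΩ
  obtain ⟨ε, hε, hε1, K, hK, hKn⟩ := exists_closest_point_bounds ho hb hU hΩU hρ hΩρ hd
  refine ⟨ε, hε, 1 / (8 + 4 * K), 16, by positivity, ?_, ?_⟩
  · rw [div_lt_iff₀ (by positivity)]
    linarith
  intro z hz w hw hzε hwε
  obtain ⟨hp, hpz⟩ := hπ z hz
  obtain ⟨hq, hqw⟩ := hπ w hw
  have hpos : ∀ x ∈ Ω, 0 < bdist Ω x := fun x hx =>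
    (isClosed_frontier.notMem_iff_infDist_pos ⟨_, hp⟩).1 fun hf =>
      (ho.frontier_eq ▸ hf).2 hx
  have hδ := hpos z hz
  have hδ' := hpos w hw
  rw [dist_comm, dist_eq_norm] at hpz hqw
  obtain ⟨hlip, hdiff⟩ := hKn z hz w hw _ hp _ hq hδ hδ' hzε hwε hpz hqw
  change |bdist Ω z - bdist Ω w| ≤
    |inner ℝ ((bdist Ω z)⁻¹ • (π z - z)) (z - w)| + K * ‖z - w‖ ^ 2 at hdiff
  have hre : |inner ℝ ((bdist Ω z)⁻¹ • (π z - z)) (z - w)| ≤ ncomp Ω π z (z - w) := by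
    have h : ∀ x y : E N, inner ℝ x y = (inner ℂ x y).re := fun x y => by
      simp [PiLp.inner_apply, Complex.inner]
    rw [ncomp_eq_norm_inner, h]
    exact Complex.abs_re_le_norm _
  have hn : ‖(bdist Ω z)⁻¹ • (π z - z)‖ = 1 := by
    rw [norm_smul, hpz, norm_inv, Real.norm_of_nonneg hδ.le, inv_mul_cancel₀ hδ.ne']
  have hvec : ‖(z - w) - (π z - π w)‖ ≤ bdist Ω z + bdist Ω w := by
    have : (z - w) - (π z - π w) = (π w - w) - (π z - z) := by abel
    rw [this, ← hpz, ← hqw, add_comm]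
    exact norm_sub_le _ _
  have hX : |ncomp Ω π z (z - w) - ncomp Ω π z (π z - π w)| ≤ bdist Ω z + bdist Ω w := by
    rw [ncomp_eq_norm_inner, ncomp_eq_norm_inner]
    refine (abs_norm_sub_norm_le _ _).trans ?_
    rw [← inner_sub_right]
    refine (norm_inner_le_norm _ _).trans ?_
    rwa [hn, one_mul]
  have hD : ‖z - w‖ ≤ ‖π z - π w‖ + (bdist Ω z + bdist Ω w) := by
    have := norm_add_le ((z - w) - (π z - π w)) (π z - π w)
    rw [sub_add_cancel] at this
    linarith
  have hX0 : 0 ≤ ncomp Ω π z (z - w) := (ncomp_eq_norm_inner Ω π z _).symm ▸ norm_nonneg _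
  have hY0 : 0 ≤ ncomp Ω π z (π z - π w) := (ncomp_eq_norm_inner Ω π z _).symm ▸ norm_nonneg _
  have hA : (Afun Ω π z w + 1) * (Real.sqrt (bdist Ω z) * Real.sqrt (bdist Ω w)) =
      ncomp Ω π z (z - w) + ‖z - w‖ ^ 2 + ‖z - w‖ * Real.sqrt (bdist Ω z) +
        Real.sqrt (bdist Ω z) * Real.sqrt (bdist Ω w) := by
    have h1 := Real.sqrt_pos.2 hδ
    have h2 := Real.sqrt_pos.2 hδ'
    rw [Afun]
    field_simp
  rw [hA]
  have hs := Real.sq_sqrt hδ.le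
  have hs' := Real.sq_sqrt hδ'.le
  have hs0 := Real.sqrt_nonneg (bdist Ω z)
  have hs0' := Real.sqrt_nonneg (bdist Ω w)
  have hMz := le_max_left (bdist Ω z) (bdist Ω w)
  have hMw := le_max_right (bdist Ω z) (bdist Ω w)
  have hM1 : max (bdist Ω z) (bdist Ω w) < 1 := max_lt (hzε.trans_le hε1) (hwε.trans_le hε1)
  have hM : max (bdist Ω z) (bdist Ω w) ≤
      Real.sqrt (bdist Ω z) * Real.sqrt (bdist Ω w) + |bdist Ω z - bdist Ω w| := by
    rcases le_total (bdist Ω z) (bdist Ω w) with h | h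
    · rw [max_eq_right h]
      nlinarith [neg_abs_le (bdist Ω z - bdist Ω w), Real.sqrt_le_sqrt h]
    · rw [max_eq_left h]
      nlinarith [le_abs_self (bdist Ω z - bdist Ω w), Real.sqrt_le_sqrt h]
  generalize max (bdist Ω z) (bdist Ω w) = M at *
  generalize ncomp Ω π z (z - w) = X at *
  generalize ncomp Ω π z (π z - π w) = Y at *
  have hD0 := norm_nonneg (z - w)
  have hd0 := norm_nonneg (π z - π w)
  generalize ‖z - w‖ = D at *
  generalize ‖π z - π w‖ = d at *
  generalize Real.sqrt (bdist Ω z) = s at *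
  generalize Real.sqrt (bdist Ω w) = s' at *
  obtain ⟨hX1, hX2⟩ := abs_le.1 hX
  constructor
  · rw [div_mul_eq_mul_div, one_mul, div_le_iff₀ (by positivity)]
    have hd2 : d ^ 2 ≤ (2 * D) ^ 2 := by gcongr
    linarith [mul_nonneg hK.le hX0, mul_nonneg hK.le (mul_nonneg hs0 hs0'),
      mul_nonneg hK.le (mul_nonneg hD0 hs0), mul_nonneg hD0 hs0, mul_nonneg hs0 hs0',
      mul_nonneg hK.le (sq_nonneg D), sq_nonneg D]
  · have hM0 : 0 < M := hδ.trans_le hMz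
    have hD2 : D ^ 2 ≤ (d + 2 * M) ^ 2 := by
      gcongr
      linarith
    have hM2 : M ^ 2 ≤ M := by
      rw [sq]
      exact mul_le_of_le_one_left hM0.le hM1.le
    linarith [sq_nonneg (d - 2 * M), sq_nonneg (D - s), sq_nonneg (s - s'), sq_nonneg d]

end InvDist
end
end

section
/- Let Ω ⊂ ℂ^N be a bounded strongly pseudoconvex domain with C^{2,α}-smooth boundary, α ∈ (0,1]. There exists ε > 0 such that for every complex geodesic φ : Δ → Ω with Euclidean diameter d_e(φ(Δ)) < ε, parametrized so that δ_Ω(φ(0)) = max_{ζ∈Δ} δ_Ω(φ(ζ)), the derivative at the origin is complex tangential at the closest boundary point: φ'(0) ∈ T_p^ℂ(∂Ω), i.e., ⟨φ'(0), η_p⟩ = 0, where p = π_Ω(φ(0)) and η_p is the outer unit normal to ∂Ω at p. -/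
open Metric Set Filter Topology MeasureTheory

noncomputable section

namespace InvDist

variable {N : ℕ}

lemma eq_zero_of_mem_frontier_sublevel {X : Type*} [TopologicalSpace X] {Ω U : Set X} {ρ : X → ℝ}
    (hΩ : IsOpen Ω) (hU : closure Ω ⊆ U) (hρ : ∀ x ∈ U, ContinuousAt ρ x)
    (hΩρ : Ω = {x ∈ U | ρ x < 0}) {p : X} (hp : p ∈ frontier Ω) : ρ p = 0 := by
  rw [hΩ.frontier_eq] at hp
  have hpU := hU hp.1
  refine le_antisymm ?_ ?_
  · by_contra! hpos
    have h1 := (hρ p hpU).eventually (lt_mem_nhds hpos)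
    obtain ⟨x, hx, hx'⟩ := ((mem_closure_iff_frequently.1 hp.1).and_eventually h1).exists
    rw [hΩρ] at hx
    exact lt_asymm hx.2 hx'
  · by_contra! hneg
    exact hp.2 (by rw [hΩρ]; exact ⟨hpU, hneg⟩)

section InteriorBall

variable {F : Type*} [NormedAddCommGroup F] [InnerProductSpace ℝ F]

/-- A functional that is nonpositive on an open half-space is a nonnegative multiple of the
functional defining that half-space. -/
lemma eq_mul_inner_of_nonpos_halfSpace (L : F →L[ℝ] ℝ) {n : F} (hn : n ≠ 0)
    (h : ∀ u, inner ℝ u n < 0 → L u ≤ 0) :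
    0 ≤ L n ∧ ∀ u, L u = L n / ‖n‖ ^ 2 * inner ℝ u n := by
  have hn2 : 0 < ‖n‖ ^ 2 := by positivity
  have hnn : inner ℝ n n = ‖n‖ ^ 2 := real_inner_self_eq_norm_sq n
  have hLn : 0 ≤ L n := by
    have := h (-n) (by rw [inner_neg_left, hnn]; linarith)
    rw [map_neg] at this
    linarith
  have key : ∀ w, inner ℝ w n = 0 → L w ≤ 0 := by
    intro w hw
    by_contra! hpos
    have hle : ∀ t : ℝ, 0 < t → L w ≤ t * L n := by
      intro t ht
      have := h (w - t • n) (by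
        rw [inner_sub_left, inner_smul_left, hw, hnn]
        simp only [conj_trivial]
        nlinarith)
      rw [map_sub, map_smul, smul_eq_mul] at this
      linarith
    have h1 := hle (L w / (2 * (L n + 1))) (by positivity)
    have h2 : L w / (2 * (L n + 1)) * L n ≤ L w / 2 := by
      rw [div_mul_eq_mul_div, div_le_div_iff₀ (by positivity) (by positivity)]
      nlinarith
    linarith
  refine ⟨hLn, fun u => ?_⟩
  set s := inner ℝ u n / ‖n‖ ^ 2 with hs
  have hsn : s * ‖n‖ ^ 2 = inner ℝ u n := div_mul_cancel₀ _ hn2.ne'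
  have hw : inner ℝ (u - s • n) n = 0 := by
    rw [inner_sub_left, inner_smul_left, hnn]
    simp only [conj_trivial]
    linarith
  have h1 := key _ hw
  have h2 := key (-(u - s • n)) (by rw [inner_neg_left, hw, neg_zero])
  rw [map_neg, map_sub, map_smul, smul_eq_mul] at h2
  rw [map_sub, map_smul, smul_eq_mul] at h1
  have : L u = s * L n := by linarith
  rw [this, hs]
  ring

lemma ball_infDist_frontier_subset {Ω : Set F} (hΩ : IsOpen Ω) {z : F} (hz : z ∈ Ω) :
    ball z (infDist z (frontier Ω)) ⊆ Ω := by
  rcases le_or_gt (infDist z (frontier Ω)) 0 with h0 | h0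
  · rw [ball_eq_empty.2 h0]
    exact empty_subset _
  refine (convex_ball z _).isPreconnected.subset_left_of_subset_union hΩ
    isClosed_closure.isOpen_compl (disjoint_compl_right.mono_left subset_closure) ?_
    ⟨z, mem_ball_self h0, hz⟩
  intro x hx
  by_contra hx'
  simp only [mem_union, mem_compl_iff, not_or, not_not] at hx'
  have hfr : x ∈ frontier Ω := by
    rw [hΩ.frontier_eq]
    exact ⟨hx'.2, hx'.1⟩
  have := infDist_le_dist_of_mem (x := z) hfr
  rw [mem_ball, dist_comm] at hx
  linarith

/-- First order Taylor estimate, uniform along a compact set. -/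
lemma exists_uniform_taylor_bound [ProperSpace F] {K U : Set F} {ρ : F → ℝ} (hK : IsCompact K)
    (hU : IsOpen U) (hKU : K ⊆ U) (hρ : ContDiffOn ℝ 2 ρ U) :
    ∃ r > 0, ∃ C > 0, ∀ p ∈ K, ball p r ⊆ U ∧
      ∀ x ∈ ball p r, |ρ x - ρ p - fderiv ℝ ρ p (x - p)| ≤ C * ‖x - p‖ ^ 2 := by
  obtain ⟨r, hr, hrU⟩ := hK.exists_cthickening_subset_open hU hKU
  have hρ' : ContDiffOn ℝ 1 (fderiv ℝ ρ) U := hρ.fderiv_of_isOpen hU (by norm_num)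
  have hloc : LocallyLipschitzOn (cthickening r K) (fderiv ℝ ρ) := by
    intro x hx
    obtain ⟨C, t, ht, hC⟩ :=
      (hρ'.contDiffAt (hU.mem_nhds (hrU hx))).exists_lipschitzOnWith
    exact ⟨C, t, mem_nhdsWithin_of_mem_nhds ht, hC⟩
  obtain ⟨C, hC⟩ := hloc.exists_lipschitzOnWith_of_compact hK.cthickening
  have hsub : ∀ p ∈ K, ball p r ⊆ cthickening r K := fun p hp x hx =>
    mem_cthickening_of_dist_le x p r K hp (mem_ball.1 hx).le
  refine ⟨r, hr, C + 1, by positivity, fun p hp => ⟨(hsub p hp).trans hrU, fun x hx => ?_⟩⟩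
  have hball : closedBall p ‖x - p‖ ⊆ ball p r :=
    closedBall_subset_ball (by rwa [← dist_eq_norm])
  have hbound : ∀ y ∈ closedBall p ‖x - p‖,
      ‖fderiv ℝ ρ y - fderiv ℝ ρ p‖ ≤ C * ‖x - p‖ := by
    intro y hy
    refine (hC.norm_sub_le (hsub p hp (hball hy)) (hsub p hp (mem_ball_self hr))).trans ?_
    gcongr
    rw [← dist_eq_norm]
    exact hy
  have := (convex_closedBall p ‖x - p‖).norm_image_sub_le_of_norm_fderiv_le'
    (fun y hy => ((hρ.contDiffAt (hU.mem_nhds (hrU (hsub p hp (hball hy))))).differentiableAt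
      (by norm_num))) hbound (mem_closedBall_self (norm_nonneg _))
    (by rw [mem_closedBall, dist_eq_norm] : x ∈ closedBall p ‖x - p‖)
  rw [Real.norm_eq_abs] at this
  nlinarith [sq_nonneg ‖x - p‖]

/-- Uniform interior ball condition for a domain with `C²` defining function. -/
lemma exists_interior_ball [ProperSpace F] {Ω U : Set F} {ρ : F → ℝ} (hΩ : IsOpen Ω)
    (hb : Bornology.IsBounded Ω) (hU : IsOpen U) (hΩU : closure Ω ⊆ U)
    (hρ : ContDiffOn ℝ 2 ρ U) (hΩρ : Ω = {x ∈ U | ρ x < 0})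
    (hd : ∀ p ∈ frontier Ω, fderiv ℝ ρ p ≠ 0) :
    ∃ r > 0, ∀ z ∈ Ω, ∀ p ∈ frontier Ω, dist z p = infDist z (frontier Ω) →
      ball (p - (r / dist z p) • (p - z)) r ⊆ Ω := by
  have hfU : frontier Ω ⊆ U := frontier_subset_closure.trans hΩU
  have hK : IsCompact (frontier Ω) := hb.isCompact_closure.of_isClosed_subset
    isClosed_frontier frontier_subset_closure
  obtain ⟨r₀, hr₀, C, hC, hT⟩ := exists_uniform_taylor_bound hK hU hfU hρ
  obtain ⟨m, hm, hm'⟩ : ∃ m > 0, ∀ p ∈ frontier Ω, m ≤ ‖fderiv ℝ ρ p‖ := by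
    have hcont : ContinuousOn (fun p => ‖fderiv ℝ ρ p‖) (frontier Ω) :=
      ((hρ.continuousOn_fderiv_of_isOpen hU (by norm_num)).mono hfU).norm
    rcases (frontier Ω).eq_empty_or_nonempty with he | hne
    · exact ⟨1, one_pos, by simp [he]⟩
    · obtain ⟨q, hq, hmin⟩ := hK.exists_isMinOn hne hcont
      exact ⟨_, norm_pos_iff.2 (hd q hq), fun p hp => hmin hp⟩
  have hzero := fun p (hp : p ∈ frontier Ω) => eq_zero_of_mem_frontier_sublevel hΩ hΩU
    (fun x hx => (hρ.contDiffAt (hU.mem_nhds hx)).continuousAt) hΩρ hp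
  obtain ⟨r, hr, hrr₀, hrC⟩ : ∃ r > 0, 2 * r ≤ r₀ ∧ 2 * r * C ≤ m := by
    refine ⟨min (r₀ / 2) (m / (2 * C)), by positivity, ?_, ?_⟩
    · linarith [min_le_left (r₀ / 2) (m / (2 * C))]
    · have := min_le_right (r₀ / 2) (m / (2 * C))
      rw [le_div_iff₀ (by positivity)] at this
      linarith
  refine ⟨r, hr, fun z hz p hp hzp x hx => ?_⟩
  have hpΩ : p ∉ Ω := by
    rw [hΩ.frontier_eq] at hp
    exact hp.2
  have hn : p - z ≠ 0 := fun h => hpΩ (by rwa [sub_eq_zero.1 h])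
  have hdist : dist z p = ‖p - z‖ := by rw [dist_comm, dist_eq_norm]
  have hball := ball_infDist_frontier_subset hΩ hz
  rw [← hzp, hdist] at hball
  rw [hdist] at hx
  set n := p - z with hn_def
  set L := fderiv ℝ ρ p with hL
  have hd0 : 0 < ‖n‖ := norm_pos_iff.2 hn
  have hhalf : ∀ u, inner ℝ u n < 0 → L u ≤ 0 := by
    intro u hu
    have hder : HasFDerivAt ρ L p :=
      ((hρ.contDiffAt (hU.mem_nhds (hfU hp))).differentiableAt (by norm_num)).hasFDerivAt
    have hline : HasDerivAt (fun t : ℝ => ρ (p + t • u)) (L u) 0 :=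
      hder.hasLineDerivAt u
    have hslope := hline.tendsto_slope_zero_right
    refine le_of_tendsto hslope ?_
    have hu0 : u ≠ 0 := by rintro rfl; simp at hu
    have hu2 : 0 < ‖u‖ ^ 2 := by positivity
    have hpos : 0 < -(2 * inner ℝ u n) / ‖u‖ ^ 2 := div_pos (by linarith) hu2
    filter_upwards [Ioo_mem_nhdsGT hpos] with t ht
    have ht2 := (lt_div_iff₀ hu2).1 ht.2
    have hmem : p + t • u ∈ Ω := by
      apply hball
      rw [mem_ball, dist_eq_norm, show p + t • u - z = n + t • u by rw [hn_def]; abel]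
      refine lt_of_pow_lt_pow_left₀ 2 (norm_nonneg _) ?_
      rw [norm_add_sq_real, inner_smul_right, norm_smul, mul_pow, Real.norm_eq_abs, sq_abs,
        real_inner_comm]
      nlinarith [mul_pos ht.1 (sub_pos.2 ht2)]
    rw [hΩρ] at hmem
    have h1 : ρ (p + t • u) < 0 := hmem.2
    simp only [zero_add, zero_smul, add_zero, hzero p hp, sub_zero, smul_eq_mul]
    exact mul_nonpos_of_nonneg_of_nonpos (inv_nonneg.2 ht.1.le) h1.le
  obtain ⟨hLn, hLu⟩ := eq_mul_inner_of_nonpos_halfSpace L hn hhalf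
  have hmL : m ≤ L n / ‖n‖ := by
    refine (hm' p hp).trans (L.opNorm_le_bound (by positivity) fun u => ?_)
    rw [hLu u, Real.norm_eq_abs, abs_mul, abs_of_nonneg (by positivity)]
    calc L n / ‖n‖ ^ 2 * |inner ℝ u n| ≤ L n / ‖n‖ ^ 2 * (‖u‖ * ‖n‖) := by
          gcongr
          exact abs_real_inner_le_norm u n
      _ = L n / ‖n‖ * ‖u‖ := by field_simp
  set y := x - p with hy
  have hyn : ‖y + (r / ‖n‖) • n‖ < r := by
    rw [mem_ball, dist_eq_norm] at hx
    rwa [show y + (r / ‖n‖) • n = x - (p - (r / ‖n‖) • n) by rw [hy]; abel]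
  have hrn : ‖(r / ‖n‖) • n‖ = r := by
    rw [norm_smul, Real.norm_eq_abs, abs_of_pos (by positivity), div_mul_cancel₀ _ hd0.ne']
  have hinner : ‖y‖ ^ 2 + 2 * (r * (inner ℝ y n / ‖n‖)) < 0 := by
    have h1 : ‖y + (r / ‖n‖) • n‖ ^ 2 < r ^ 2 := by gcongr
    rw [norm_add_sq_real, hrn, inner_smul_right] at h1
    have : r / ‖n‖ * inner ℝ y n = r * (inner ℝ y n / ‖n‖) := by ring
    linarith
  have hxr : x ∈ ball p r₀ := by
    rw [mem_ball, dist_eq_norm, ← hy]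
    have := norm_sub_le (y + (r / ‖n‖) • n) ((r / ‖n‖) • n)
    rw [add_sub_cancel_right, hrn] at this
    linarith
  obtain ⟨hpU, hpT⟩ := hT p hp
  have hTx := (abs_le.1 (hpT x hxr)).2
  rw [hzero p hp, ← hy, ← hL, hLu y] at hTx
  have heq : L n / ‖n‖ ^ 2 * inner ℝ y n = L n / ‖n‖ * (inner ℝ y n / ‖n‖) := by
    field_simp
  rw [heq] at hTx
  set s := inner ℝ y n / ‖n‖
  have hs : s < 0 := by nlinarith [sq_nonneg ‖y‖]
  have h1 : L n / ‖n‖ * s ≤ m * s := mul_le_mul_of_nonpos_right hmL hs.le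
  have h2 : m * s ≤ 2 * r * C * s := mul_le_mul_of_nonpos_right hrC hs.le
  rw [hΩρ]
  exact ⟨hpU hxr, by nlinarith⟩

end InteriorBall

lemma artanh_le_artanh {a b : ℝ} (ha : -1 < a) (hab : a ≤ b) (hb : b < 1) :
    artanh a ≤ artanh b := by
  unfold artanh
  have h : (1 + a) / (1 - a) ≤ (1 + b) / (1 - b) := by
    rw [div_le_div_iff₀ (by linarith) (by linarith)]
    nlinarith
  have := Real.log_le_log (div_pos (by linarith) (by linarith)) h
  linarith

lemma artanh_lt_artanh {a b : ℝ} (ha : -1 < a) (hab : a < b) (hb : b < 1) :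
    artanh a < artanh b := by
  unfold artanh
  have h : (1 + a) / (1 - a) < (1 + b) / (1 - b) := by
    rw [div_lt_div_iff₀ (by linarith) (by linarith)]
    nlinarith
  have := Real.log_lt_log (div_pos (by linarith) (by linarith)) h
  linarith

lemma artanh_zero : artanh 0 = 0 := by simp [artanh]

lemma lempert_nonneg (Ω : Set (E N)) (z w : E N) : 0 ≤ lempert Ω z w := by
  unfold lempert
  set S := { r : ℝ | ∃ φ : ℂ → E N, DifferentiableOn ℂ φ (ball 0 1) ∧
    MapsTo φ (ball (0:ℂ) 1) Ω ∧ φ 0 = z ∧ ∃ a ∈ ball (0:ℂ) 1, φ a = w ∧ r = ‖a‖ }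
  have hS0 : ∀ r ∈ S, 0 ≤ r ∧ r < 1 := by
    rintro r ⟨φ, -, -, -, a, ha, -, rfl⟩
    exact ⟨norm_nonneg _, by simpa using ha⟩
  have h0 : 0 ≤ sInf S := Real.sInf_nonneg fun r hr => (hS0 r hr).1
  have h1 : sInf S < 1 := by
    rcases S.eq_empty_or_nonempty with he | ⟨r, hr⟩
    · rw [he, Real.sInf_empty]
      exact one_pos
    · exact (csInf_le ⟨0, fun r hr => (hS0 r hr).1⟩ hr).trans_lt (hS0 r hr).2
  rw [← artanh_zero]
  exact artanh_le_artanh (by norm_num) h0 h1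

lemma kobayashi_le_lempert {Ω : Set (E N)} {z w : E N} (hz : z ∈ Ω) (hw : w ∈ Ω) :
    kobayashi Ω z w ≤ lempert Ω z w := by
  refine csInf_le ⟨0, ?_⟩ ⟨1, ![z, w], rfl, rfl, ?_, by simp⟩
  · rintro r ⟨n, p, -, -, -, rfl⟩
    exact Finset.sum_nonneg fun i _ => lempert_nonneg _ _ _
  · intro i
    fin_cases i
    · exact hz
    · exact hw

lemma lempert_le_artanh_of_ball_subset {Ω : Set (E N)} {z w : E N} {d a : ℝ}
    (hd : ball z d ⊆ Ω) (ha : 0 < a) (ha1 : a < 1) (hw : ‖w - z‖ ≤ a * d) (hd0 : 0 < d) :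
    lempert Ω z w ≤ artanh a := by
  have hbdd : ∀ r ∈ { r : ℝ | ∃ φ : ℂ → E N, DifferentiableOn ℂ φ (ball 0 1) ∧
      MapsTo φ (ball (0:ℂ) 1) Ω ∧ φ 0 = z ∧ ∃ a ∈ ball (0:ℂ) 1, φ a = w ∧ r = ‖a‖ }, 0 ≤ r := by
    rintro r ⟨φ, -, -, -, a, -, -, rfl⟩
    exact norm_nonneg _
  have hna : ‖(a : ℂ)‖ = a := by rw [Complex.norm_real, Real.norm_eq_abs, abs_of_pos ha]
  have haC : (a : ℂ) ≠ 0 := by exact_mod_cast ha.ne'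
  refine artanh_le_artanh (by linarith [Real.sInf_nonneg hbdd]) (csInf_le ⟨0, hbdd⟩ ?_) ha1
  refine ⟨fun l => z + (l / a) • (w - z), by fun_prop, ?_, by simp, a,
    by rwa [mem_ball_zero_iff, hna], ?_, hna.symm⟩
  · intro l hl
    have hl1 : ‖l‖ < 1 := by simpa using hl
    apply hd
    rw [mem_ball, dist_eq_norm, add_sub_cancel_left, norm_smul, norm_div, hna]
    calc ‖l‖ / a * ‖w - z‖ ≤ ‖l‖ / a * (a * d) := by gcongr
      _ = ‖l‖ * d := by field_simp
      _ < d := by nlinarith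
  · simp [div_self haC]

/-- The image of a complex geodesic has diameter at least the boundary distance of its center. -/
lemma IsComplexGeodesic.bdist_le_diam {Ω : Set (E N)} (hΩ : IsOpen Ω)
    (hb : Bornology.IsBounded Ω) {φ : ℂ → E N} (hφ : IsComplexGeodesic Ω φ) :
    bdist Ω (φ 0) ≤ diam (φ '' ball (0:ℂ) 1) := by
  obtain ⟨-, hmaps, hiso⟩ := hφ
  by_contra! hlt
  set D := diam (φ '' ball (0:ℂ) 1)
  set d := bdist Ω (φ 0)
  have h0 : (0:ℂ) ∈ ball (0:ℂ) 1 := mem_ball_self one_pos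
  have hD : 0 ≤ D := diam_nonneg
  have hd0 : 0 < d := hD.trans_lt hlt
  obtain ⟨a, hDa, had⟩ := exists_between hlt
  have ha : 0 < a / d := div_pos (hD.trans_lt hDa) hd0
  have ha1 : a / d < 1 := (div_lt_one hd0).2 had
  obtain ⟨t, hat, ht1⟩ := exists_between ha1
  have hnt : ‖(t : ℂ)‖ = t := by
    rw [Complex.norm_real, Real.norm_eq_abs, abs_of_pos (ha.trans hat)]
  have ht : (t : ℂ) ∈ ball (0:ℂ) 1 := by rwa [mem_ball_zero_iff, hnt]
  have hdist : ‖φ t - φ 0‖ ≤ a / d * d := by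
    rw [div_mul_cancel₀ _ hd0.ne', ← dist_eq_norm]
    exact (dist_le_diam_of_mem (hb.subset (image_subset_iff.2 hmaps))
      (mem_image_of_mem φ ht) (mem_image_of_mem φ h0)).trans hDa.le
  have h1 := (kobayashi_le_lempert (hmaps h0) (hmaps ht)).trans
    (lempert_le_artanh_of_ball_subset (ball_infDist_frontier_subset hΩ (hmaps h0)) ha ha1
      hdist hd0)
  rw [hiso 0 h0 t ht] at h1
  have h2 : poincare 0 t = artanh t := by simp [poincare, abs_of_pos (ha.trans hat)]
  rw [h2] at h1
  exact absurd h1 (not_le.2 (artanh_lt_artanh (by linarith) hat ht1))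

lemma re_herm (a b : E N) : (herm a b).re = inner ℝ b a := by
  simp [herm, PiLp.inner_apply, Complex.inner]

lemma herm_smul_left (c : ℂ) (a b : E N) : herm (c • a) b = c * herm a b := by
  simp [herm, Finset.mul_sum, mul_assoc]

/-- If the distance to `c` along a holomorphic curve is locally minimal, the derivative is
Hermitian orthogonal to the direction of `c`. -/
lemma herm_deriv_eq_zero_of_isLocalMin_dist {φ : ℂ → E N} {ζ : ℂ} {c : E N}
    (hφ : DifferentiableAt ℂ φ ζ) (hmin : IsLocalMin (fun x => ‖φ x - c‖ ^ 2) ζ) :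
    herm (deriv φ ζ) (φ ζ - c) = 0 := by
  have hre : ∀ u : ℂ, (herm (u • deriv φ ζ) (φ ζ - c)).re = 0 := by
    intro u
    have hlin : HasDerivAt (fun t : ℝ => ζ + (t : ℂ) * u) u 0 := by
      simpa using ((Complex.ofRealCLM.hasDerivAt (x := 0)).mul_const u).const_add ζ
    have hφ' : HasDerivAt φ (deriv φ ζ) (ζ + ((0 : ℝ) : ℂ) * u) := by
      simpa using hφ.hasDerivAt
    have hcomp : HasDerivAt (fun t : ℝ => φ (ζ + (t : ℂ) * u) - c) (u • deriv φ ζ) 0 :=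
      (hφ'.scomp (0 : ℝ) hlin).sub_const c
    have hsq := hcomp.norm_sq
    have hcont : Tendsto (fun t : ℝ => ζ + (t : ℂ) * u) (𝓝 0) (𝓝 ζ) := by
      simpa using hlin.continuousAt.tendsto
    have hmin' : IsLocalMin (fun t : ℝ => ‖φ (ζ + (t : ℂ) * u) - c‖ ^ 2) 0 := by
      have := hcont.eventually hmin
      simpa [IsLocalMin, IsMinFilter] using this
    have := hmin'.hasDerivAt_eq_zero hsq
    rw [re_herm]
    simpa using this
  apply Complex.ext
  · simpa using hre 1
  · have := hre Complex.I
    rw [herm_smul_left] at this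
    simpa using this

lemma herm_real_smul_right (s : ℝ) (a b : E N) : herm a (s • b) = s * herm a b := by
  simp [herm, Finset.mul_sum, mul_left_comm]

/-- For a complex geodesic of sufficiently small diameter,
parametrized so that the maximal boundary distance is attained at the origin, the
derivative at the origin is complex tangential at the closest boundary point. -/
theorem stmt10 {N : ℕ} {α : ℝ} (hα : α ∈ Set.Ioc (0:ℝ) 1)
    (Ω : Set (E N)) (hΩ : IsStronglyPseudoconvexDomain 2 α Ω)
    (π : E N → E N) (hπ : IsClosestPointSelection Ω π) :
    ∃ ε : ℝ, 0 < ε ∧ ∀ φ : ℂ → E N, IsComplexGeodesic Ω φ →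
      Metric.diam (φ '' ball (0:ℂ) 1) < ε →
      (∀ ζ ∈ ball (0:ℂ) 1, bdist Ω (φ ζ) ≤ bdist Ω (φ 0)) →
      herm (deriv φ 0) (π (φ 0) - φ 0) = 0 := by
  obtain ⟨hopen, -, hb, U, ρ, hU, hΩU, ⟨hρ, -⟩, hΩρ, hd, -⟩ := hΩ
  obtain ⟨r, hr, hball⟩ := exists_interior_ball hopen hb hU hΩU hρ hΩρ hd
  refine ⟨r, hr, fun φ hφ hdiam hmax => ?_⟩
  have h0 : (0:ℂ) ∈ ball (0:ℂ) 1 := mem_ball_self one_pos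
  have hz : φ 0 ∈ Ω := hφ.2.1 h0
  obtain ⟨hp, hzp⟩ := hπ _ hz
  have hlt : bdist Ω (φ 0) < r := (hφ.bdist_le_diam hopen hb).trans_lt hdiam
  have hin := hball _ hz _ hp hzp
  set z := φ 0 with hz_def
  set p := π z
  set c := p - (r / dist z p) • (p - z) with hc
  have hdz : 0 < dist z p := by
    refine dist_pos.2 fun h => ?_
    rw [hopen.frontier_eq] at hp
    exact hp.2 (h ▸ hz)
  rw [← hzp] at hlt
  have hzc : z - c = (r / dist z p - 1) • (p - z) := by rw [hc, sub_smul, one_smul]; abel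
  have hk : 0 < r / dist z p - 1 := sub_pos.2 ((one_lt_div hdz).2 hlt)
  have hnzc : ‖z - c‖ = r - dist z p := by
    rw [hzc, norm_smul, Real.norm_eq_abs, abs_of_pos hk, ← dist_eq_norm, dist_comm p z, sub_mul,
      div_mul_cancel₀ _ hdz.ne', one_mul]
  have hlow : ∀ x, r - ‖x - c‖ ≤ bdist Ω x := by
    intro x
    refine (le_infDist ⟨p, hp⟩).2 fun y hy => ?_
    rw [hopen.frontier_eq] at hy
    have hyc : r ≤ dist y c := by
      by_contra! h
      exact hy.2 (hin h)
    have := dist_triangle y x c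
    rw [dist_comm y x, dist_eq_norm x c] at this
    linarith
  have hmin : IsLocalMin (fun x => ‖φ x - c‖ ^ 2) 0 := by
    filter_upwards [isOpen_ball.mem_nhds h0] with x hx
    have h1 := hlow (φ x)
    have h2 := hmax x hx
    rw [← hzp] at h2
    change ‖z - c‖ ^ 2 ≤ _
    gcongr
    linarith
  have hfin := herm_deriv_eq_zero_of_isLocalMin_dist
    (hφ.1.differentiableAt (isOpen_ball.mem_nhds h0)) hmin
  rw [← hz_def, hzc, herm_real_smul_right] at hfin
  exact (mul_eq_zero.1 hfin).resolve_left (by exact_mod_cast hk.ne')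

end InvDist
end
end
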